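/- (Axis-separated pairs in positive-measure sets) Let n ≥ 1 and let X = (X_1,…,X_n) be distributed according to the n-fold product measure μ^{⊗n}, where μ is a probability measure on ℝ with a density g bounded by M := sup_x g(x) < ∞. Fix δ ∈ (0,1] and set ε' = δ/(2M). Then every measurable set E ⊆ ℝ^n with ℙ(X ∈ E) ≥ δ has the property that for every coordinate j ∈ {1,…,n} there exist points x, y ∈ E with x_k = y_k for all k ≠ j and |x_j − y_j| ≥ ε'. -/

import Mathlib

open MeasureTheory
open scoped ENNReal

/-- A measure with a density bounded by `M` gives a set of pairwise distances at most `d` mass at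
most `M * d`. -/
theorem withDensity_le_of_forall_abs_sub_le {g : ℝ → ℝ} {M d : ℝ} (hM : 0 ≤ M)
    (hg : ∀ t, g t ≤ M) {S : Set ℝ} (hS : MeasurableSet S)
    (hd : ∀ x ∈ S, ∀ y ∈ S, |x - y| ≤ d) :
    volume.withDensity (fun t => ENNReal.ofReal (g t)) S ≤ ENNReal.ofReal (M * d) := by
  have hvol : volume S ≤ ENNReal.ofReal d := by
    refine (Real.volume_le_diam S).trans (Metric.ediam_le fun x hx y hy => ?_)
    rw [edist_dist, Real.dist_eq]
    exact ENNReal.ofReal_le_ofReal (hd x hx y hy)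
  calc volume.withDensity (fun t => ENNReal.ofReal (g t)) S
      = ∫⁻ t in S, ENNReal.ofReal (g t) := withDensity_apply _ hS
    _ ≤ ∫⁻ _ in S, ENNReal.ofReal M :=
        lintegral_mono fun t => ENNReal.ofReal_le_ofReal (hg t)
    _ = ENNReal.ofReal M * volume S := setLIntegral_const S _
    _ ≤ ENNReal.ofReal M * ENNReal.ofReal d := by gcongr
    _ = ENNReal.ofReal (M * d) := (ENNReal.ofReal_mul hM).symm

/-- If all fibers of a set in the `j`-th coordinate direction have mass at most `c`, so does the
set. -/
theorem measure_pi_le_of_forall_fiber_le {m : ℕ} (μ : Measure ℝ) [IsProbabilityMeasure μ]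
    (j : Fin (m + 1)) {E : Set (Fin (m + 1) → ℝ)} (hE : MeasurableSet E) {c : ℝ≥0∞}
    (hc : ∀ y : Fin m → ℝ, μ {t | j.insertNth t y ∈ E} ≤ c) :
    Measure.pi (fun _ : Fin (m + 1) => μ) E ≤ c := by
  have hmp := (measurePreserving_piFinSuccAbove (fun _ : Fin (m + 1) => μ) j).symm
  rw [← hmp.measure_preimage hE.nullMeasurableSet,
    Measure.prod_apply_symm (hmp.measurable hE)]
  calc _ ≤ ∫⁻ _, c ∂(Measure.pi fun _ : Fin m => μ) := lintegral_mono fun y => hc y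
    _ = c := by simp

/-- **Axis-separated pairs in positive-measure sets.**
Let μ be a probability measure on ℝ with a bounded density g, let M = ⨆ x, g x be its
supremum, and fix δ ∈ (0,1] and ε' = δ/(2M). Then every measurable set E ⊆ ℝⁿ of
μ^{⊗n}-measure at least δ contains, for every coordinate j, two points that agree on all
coordinates except j, where they differ by at least ε'. -/
theorem axis_separated_pair
    (n : ℕ) (hn : 1 ≤ n)
    (μ : Measure ℝ) [IsProbabilityMeasure μ]
    (g : ℝ → ℝ) (hgmeas : Measurable g) (hg0 : ∀ t, 0 ≤ g t)
    (hμ : μ = volume.withDensity (fun t => ENNReal.ofReal (g t)))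
    (hbdd : BddAbove (Set.range g))
    (δ : ℝ) (hδ0 : 0 < δ) (hδ1 : δ ≤ 1)
    (E : Set (Fin n → ℝ)) (hE : MeasurableSet E)
    (hPE : ENNReal.ofReal δ ≤ Measure.pi (fun _ : Fin n => μ) E) :
    ∀ j : Fin n, ∃ x ∈ E, ∃ y ∈ E,
      (∀ k, k ≠ j → x k = y k) ∧ δ / (2 * ⨆ t, g t) ≤ |x j - y j| := by
  intro j
  obtain ⟨m, rfl⟩ : ∃ m, n = m + 1 := ⟨n - 1, by omega⟩
  by_contra! h
  have hle : ∀ t, g t ≤ ⨆ t, g t := le_ciSup hbdd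
  have hM : 0 ≤ ⨆ t, g t := (hg0 0).trans (hle 0)
  have hmul : (⨆ t, g t) * (δ / (2 * ⨆ t, g t)) ≤ δ / 2 := by
    rcases hM.eq_or_lt with h0 | hpos
    · rw [← h0]
      simpa using (half_pos hδ0).le
    · exact le_of_eq (by field_simp)
  have hpi : Measure.pi (fun _ : Fin (m + 1) => μ) E ≤ ENNReal.ofReal (δ / 2) := by
    refine measure_pi_le_of_forall_fiber_le μ j hE fun y => ?_
    have hmeas : MeasurableSet {t : ℝ | j.insertNth (α := fun _ => ℝ) t y ∈ E} := by
      refine measurableSet_preimage ?_ hE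
      exact (MeasurableEquiv.piFinSuccAbove (fun _ : Fin (m + 1) => ℝ) j).symm.measurable.comp
        (measurable_id.prodMk measurable_const)
    rw [hμ]
    refine (withDensity_le_of_forall_abs_sub_le hM hle hmeas fun s hs t ht => ?_).trans
      (ENNReal.ofReal_le_ofReal hmul)
    have hst := h _ hs _ ht fun k hk => by
      obtain ⟨i, rfl⟩ := Fin.exists_succAbove_eq hk
      simp
    simpa using hst.le
  have hδ := (ENNReal.ofReal_le_ofReal_iff (by positivity)).1 (hPE.trans hpi)
  linarith
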